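/- Graph Reducibility: for every orthogonal constructor rewrite system R and every term t, the following are equivalent: (1) t →^n u in R with u a normal form; (2) [t] →^n G in [R] with G a normal form and ⟦G⟧ = u. In particular, the number of rewrite steps is the same. -/

import Mathlib

/-- Pure untyped λ-terms with named variables. -/
inductive Tm : Type
  | var : ℕ → Tm
  | lam : ℕ → Tm → Tm
  | app : Tm → Tm → Tm
deriving DecidableEq

namespace Tm

/-- Free variables. -/
def fv : Tm → Finset ℕ
  | var x => {x}
  | lam x M => fv M \ {x}
  | app M N => fv M ∪ fv N

/-- A term is closed when it has no free variables. -/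
def Closed (M : Tm) : Prop := fv M = ∅

/-- Values: variables and abstractions. -/
def IsValue : Tm → Prop
  | var _ => True
  | lam _ _ => True
  | app _ _ => False

/-- (Naive) substitution `M{N/x}`. -/
def subst : Tm → ℕ → Tm → Tm
  | var y, x, N => if y = x then N else var y
  | lam y P, x, N => if y = x then lam y P else lam y (subst P x N)
  | app P Q, x, N => app (subst P x N) (subst Q x N)

/-- Weak call-by-value reduction: β-redexes whose argument is a value,
closed under both application contexts, never under λ. -/
inductive Cbv : Tm → Tm → Prop
  | beta {x M V} : IsValue V → Cbv (app (lam x M) V) (subst M x V)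
  | appL {M N L} : Cbv M N → Cbv (app M L) (app N L)
  | appR {M N L} : Cbv M N → Cbv (app L M) (app L N)

/-- The subterm relation on λ-terms. -/
inductive Sub : Tm → Tm → Prop
  | refl (M) : Sub M M
  | lam {M N x} : Sub M N → Sub M (lam x N)
  | appL {M N L} : Sub M N → Sub M (app N L)
  | appR {M N L} : Sub M L → Sub M (app N L)

end Tm

/-- `M N₁ … Nₖ` (left-nested application). -/
def appList : Tm → List Tm → Tm := List.foldl Tm.app

/-- `λx₁.…λxₖ.M`. -/
def lams : List ℕ → Tm → Tm := fun xs M => xs.foldr Tm.lam M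

/-- `stepsN R n a b`: `a` reduces to `b` in exactly `n` `R`-steps. -/
def stepsN {α : Type*} (R : α → α → Prop) : ℕ → α → α → Prop
  | 0, a, b => a = b
  | n + 1, a, b => ∃ c, R a c ∧ stepsN R n c b

/-- `a` is an `R`-normal form. -/
def NormalForm {α : Type*} (R : α → α → Prop) (a : α) : Prop := ¬ ∃ b, R a b

/-- First-order constructor terms over a signature with constructors
`c_0,…,c_{g-1}` (indices as naturals). -/
inductive CTm : Type
  | mk : ℕ → List CTm → CTm

/-- Well-formed constructor terms over the signature with `g` constructors of
arities `ar`. -/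
inductive CTm.WFC (g : ℕ) (ar : Fin g → ℕ) : CTm → Prop
  | mk {i : ℕ} {ts : List CTm} (h : i < g) :
      ts.length = ar ⟨i, h⟩ → (∀ t ∈ ts, CTm.WFC g ar t) →
      CTm.WFC g ar (CTm.mk i ts)

/-- Scott encoding of constructor terms:
`⌈cᵢ(t₁,…,tₙ)⌉ = λx₁…λx_g.λy. xᵢ ⌈t₁⌉…⌈tₙ⌉`. -/
def CTm.encode (g : ℕ) : CTm → Tm
  | .mk i ts =>
      lams (List.range (g + 1))
        (appList (.var i) (ts.attach.map fun t => CTm.encode g t.1))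
termination_by t => sizeOf t
decreasing_by all_goals first
  | (simp_wf; have := List.sizeOf_lt_of_mem t.2; omega)
  | (simp_wf; omega)
  | simp_wf

/-- The error value `⊥ = λx₁…λx_g.λy.y`. -/
def errTm (g : ℕ) : Tm := lams (List.range (g + 1)) (.var g)

/-- The λ-term `⌈cᵢ⌉ = λx₁…λx_{ar i}.λy₁…λy_g.λz. yᵢ x₁ … x_{ar i}`
computing the constructor `cᵢ`. -/
def encC (g : ℕ) (ar : Fin g → ℕ) (i : Fin g) : Tm :=
  lams (List.range' (g + 1) (ar i) ++ List.range (g + 1))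
    (appList (.var i.val) ((List.range' (g + 1) (ar i)).map .var))

/-- Simultaneous (sequential, for closed replacements) substitution. -/
def substL (M : Tm) (xs : List ℕ) (Ns : List Tm) : Tm :=
  (xs.zip Ns).foldl (fun acc p => Tm.subst acc p.1 p.2) M

/-- The terms `CON^i_{x₁,…,x_m}` (free variables `x_t = g+1+t`), defined by
downward recursion on `ar i - m` (the first argument is the fuel
`ar i - m`): the base case is `λy₁…λy_g.λz.yᵢ x₁…x_{ar i}`, the step case is
`λy. y N^m_{1,i} … N^m_{g,i} L^m_i` with
`N^m_{j,i} = λz₁…z_{ar j}.(λx_{m+1}.CON^i_{x₁,…,x_{m+1}}) CON^j_{z₁,…,z_{ar j}}`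
and `L^m_i = λz_{m+2}…λz_{ar i}.⊥`. -/
def CONf (g : ℕ) (ar : Fin g → ℕ) : ℕ → Fin g → List ℕ → Tm
  | 0, i, xs => lams (List.range (g + 1)) (appList (.var i.val) (xs.map .var))
  | (k+1), i, xs =>
      Tm.lam (2 * (g + 2 + Finset.univ.sup ar) + 2)
        (appList (.var (2 * (g + 2 + Finset.univ.sup ar) + 2))
          ((List.ofFn fun j : Fin g =>
              lams (List.range' (g + 2 + Finset.univ.sup ar) (ar j))
                (Tm.app
                  (Tm.lam (g + 1 + xs.length)
                    (CONf g ar k i (xs ++ [g + 1 + xs.length])))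
                  (CONf g ar 0 j
                    (List.range' (g + 2 + Finset.univ.sup ar) (ar j))))) ++
            [lams (List.range' (g + 2 + Finset.univ.sup ar) (ar i - xs.length - 1))
              (errTm g)]))
termination_by k => k

/-- `CON^i_{x₁,…,x_m}` with the canonical variable names `x_t = g+1+t`. -/
def CON (g : ℕ) (ar : Fin g → ℕ) (i : Fin g) (m : ℕ) : Tm :=
  CONf g ar (ar i - m) i ((List.range m).map (g + 1 + ·))

/-- Patterns: terms built from constructors and variables. -/
inductive Pat : Type
  | pv : ℕ → Pat
  | pc : ℕ → List Pat → Pat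

namespace Pat

/-- Well-formed patterns over the signature. -/
inductive WFP (g : ℕ) (ar : Fin g → ℕ) : Pat → Prop
  | pv (x) : WFP g ar (pv x)
  | pc {i : ℕ} {ps : List Pat} (h : i < g) :
      ps.length = ar ⟨i, h⟩ → (∀ p ∈ ps, WFP g ar p) → WFP g ar (pc i ps)

/-- The variables of a pattern, in left-to-right order. -/
def vars : Pat → List ℕ
  | pv x => [x]
  | pc _ ps => (ps.attach.map fun p => vars p.1).flatten
termination_by p => sizeOf p
decreasing_by all_goals first
  | (simp_wf; have := List.sizeOf_lt_of_mem p.2; omega)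
  | (simp_wf; omega)
  | simp_wf

/-- Instantiation of a pattern by a substitution assigning constructor terms
to variables. -/
def inst (σ : ℕ → CTm) : Pat → CTm
  | pv x => σ x
  | pc i ps => CTm.mk i (ps.attach.map fun p => inst σ p.1)
termination_by p => sizeOf p
decreasing_by all_goals first
  | (simp_wf; have := List.sizeOf_lt_of_mem p.2; omega)
  | (simp_wf; omega)
  | simp_wf

end Pat

/-- A sequence of constructor terms matches a sequence of patterns when it is
obtained by instantiating the pattern variables with constructor terms. -/
def MatchesSeq (α : List Pat) (ts : List CTm) : Prop :=
  ∃ σ : ℕ → CTm, ts = α.map (Pat.inst σ)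

/-- The variables of a sequence of patterns, in order. -/
def seqVars (α : List Pat) : List ℕ := (α.map Pat.vars).flatten

/-- Terms of a constructor rewrite system: variables, constructors `c_i`,
function symbols `f_j` (indices as naturals). -/
inductive XTm : Type
  | xv : ℕ → XTm
  | xc : ℕ → List XTm → XTm
  | xf : ℕ → List XTm → XTm

/-- Embedding constructor terms into general terms. -/
def CTm.toX : CTm → XTm
  | .mk i ts => .xc i (ts.attach.map fun t => CTm.toX t.1)
termination_by t => sizeOf t
decreasing_by all_goals first
  | (simp_wf; have := List.sizeOf_lt_of_mem t.2; omega)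
  | (simp_wf; omega)
  | simp_wf

/-- Instantiation of a term by a substitution assigning constructor terms
to variables. -/
def XTm.instX (σ : ℕ → CTm) : XTm → XTm
  | .xv x => CTm.toX (σ x)
  | .xc i ts => .xc i (ts.attach.map fun t => XTm.instX σ t.1)
  | .xf f ts => .xf f (ts.attach.map fun t => XTm.instX σ t.1)
termination_by t => sizeOf t
decreasing_by all_goals first
  | (simp_wf; have := List.sizeOf_lt_of_mem t.2; omega)
  | (simp_wf; omega)
  | simp_wf

/-- `t` is (the image of) a constructor term. -/
inductive XTm.IsC : XTm → Prop
  | xc {i ts} : (∀ t ∈ ts, XTm.IsC t) → XTm.IsC (.xc i ts)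

/-- A rewrite rule `f(s₁,…,sₖ) → r`: function symbol, pattern arguments,
right-hand side. -/
abbrev XRule := ℕ × List Pat × XTm

/-- Call-by-value rewriting for a constructor rewrite system: a rule
`f(s⃗) → r` fires when the arguments are the patterns instantiated by
constructor terms, and rewriting is closed under arbitrary contexts. -/
inductive XRew (R : List XRule) : XTm → XTm → Prop
  | root {f : ℕ} {ps : List Pat} {r : XTm} {σ : ℕ → CTm} :
      (f, ps, r) ∈ R →
      XRew R (.xf f (ps.map fun p => CTm.toX (Pat.inst σ p))) (XTm.instX σ r)
  | congC {i t t' l r} : XRew R t t' →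
      XRew R (.xc i (l ++ t :: r)) (.xc i (l ++ t' :: r))
  | congF {f t t' l r} : XRew R t t' →
      XRew R (.xf f (l ++ t :: r)) (.xf f (l ++ t' :: r))

/-- The variables occurring in a term. -/
def XTm.varsX : XTm → List ℕ
  | .xv x => [x]
  | .xc _ ts => (ts.attach.map fun t => XTm.varsX t.1).flatten
  | .xf _ ts => (ts.attach.map fun t => XTm.varsX t.1).flatten
termination_by t => sizeOf t
decreasing_by all_goals first
  | (simp_wf; have := List.sizeOf_lt_of_mem t.2; omega)
  | (simp_wf; omega)
  | simp_wf

/-- Pattern as a term. -/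
def Pat.toX : Pat → XTm
  | .pv x => .xv x
  | .pc i ps => .xc i (ps.attach.map fun p => Pat.toX p.1)
termination_by p => sizeOf p
decreasing_by all_goals first
  | (simp_wf; have := List.sizeOf_lt_of_mem p.2; omega)
  | (simp_wf; omega)
  | simp_wf

/-- Closed terms (no variables). -/
inductive XTm.ClosedX : XTm → Prop
  | xc {i ts} : (∀ t ∈ ts, XTm.ClosedX t) → XTm.ClosedX (.xc i ts)
  | xf {f ts} : (∀ t ∈ ts, XTm.ClosedX t) → XTm.ClosedX (.xf f ts)

/-- Vertex labels of term graphs: `Sum.inl x` is an unlabelled (variable)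
node carrying the variable name `x`; `Sum.inr (Sum.inl c)` is the constructor
`c`; `Sum.inr (Sum.inr f)` is the function symbol `f`. -/
abbrev GLab := ℕ ⊕ (ℕ ⊕ ℕ)

/-- A node: its label together with the ordered list of its successors. -/
abbrev GNode := GLab × List ℕ

/-- Term graphs: a finite set of vertices `{0,…,n-1}` with a labelling and an
ordered successor function, and a root. -/
structure TG where
  n : ℕ
  label : ℕ → GLab
  succ : ℕ → List ℕ
  root : ℕ

namespace TG

/-- The edge relation of a term graph. -/
def Edge (G : TG) (u v : ℕ) : Prop := u < G.n ∧ v ∈ G.succ u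

/-- Reachability. -/
def Reach (G : TG) : ℕ → ℕ → Prop := Relation.ReflTransGen G.Edge

/-- `IsPath G u v l`: `l` is a path from `u` to `v` following edges of `G`. -/
inductive IsPath (G : TG) : ℕ → ℕ → List ℕ → Prop
  | single (v) : IsPath G v v [v]
  | cons {u w v l} : u < G.n → w ∈ G.succ u → IsPath G w v l →
      IsPath G u v (u :: l)

/-- Every path starting in `v` is a constructor path (equivalently: every
vertex reachable from `v`, including `v`, is labelled by a constructor). -/
def ConPathsFrom (G : TG) (v : ℕ) : Prop :=
  ∀ w, G.Reach v w → ∃ c, G.label w = Sum.inr (Sum.inl c)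

/-- Constructor-sharedness: any vertex reachable from the root by two
distinct paths only starts constructor paths. -/
def ConShared (G : TG) : Prop :=
  ∀ v l₁ l₂, G.IsPath G.root v l₁ → G.IsPath G.root v l₂ → l₁ ≠ l₂ →
    G.ConPathsFrom v

/-- A term graph is closed when the labelling is total (on the relevant,
reachable part). -/
def ClosedG (G : TG) : Prop :=
  ∀ v, G.Reach G.root v → ∃ s, G.label v = Sum.inr s

/-- Well-formed term graphs over the signature: the root is a vertex, edges
stay inside the graph, arities of labels match out-degrees, unlabelled nodes
have out-degree 0, and the graph is acyclic. -/
def WFG (g : ℕ) (arC : Fin g → ℕ) (h : ℕ) (arF : Fin h → ℕ) (G : TG) : Prop :=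
  G.root < G.n ∧
  (∀ v < G.n, ∀ w ∈ G.succ v, w < G.n) ∧
  (∀ v < G.n,
    (∀ x, G.label v = Sum.inl x → G.succ v = []) ∧
    (∀ c, G.label v = Sum.inr (Sum.inl c) →
      ∃ hc : c < g, (G.succ v).length = arC ⟨c, hc⟩) ∧
    (∀ f, G.label v = Sum.inr (Sum.inr f) →
      ∃ hf : f < h, (G.succ v).length = arF ⟨f, hf⟩)) ∧
  (∃ rank : ℕ → ℕ, ∀ v < G.n, ∀ w ∈ G.succ v, rank w < rank v)

/-- Unfolding of a term graph from a vertex, with fuel. -/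
def unfoldA (G : TG) : ℕ → ℕ → XTm
  | 0, v => .xv v
  | k + 1, v =>
    match G.label v with
    | .inl x => .xv x
    | .inr (.inl c) => .xc c ((G.succ v).map (G.unfoldA k))
    | .inr (.inr f) => .xf f ((G.succ v).map (G.unfoldA k))

/-- The unfolding `⟦G⟧` of an (acyclic) term graph to a term. -/
def unfold (G : TG) : XTm := G.unfoldA (G.n + 1) G.root

end TG

mutual
/-- Flattening of a term into a list of graph nodes starting at index `o`;
variables in the domain of `vm` become references to existing nodes (used for
the right-hand sides of rules). Returns the reference of the root and the
list of created nodes. -/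
def flatM (vm : ℕ → Option ℕ) : ℕ → XTm → ℕ × List GNode
  | o, .xv x =>
    match vm x with
    | some i => (i, [])
    | none => (o, [(Sum.inl x, [])])
  | o, .xc c ts =>
    let p := flatML vm (o + 1) ts
    (o, (Sum.inr (Sum.inl c), p.1) :: p.2)
  | o, .xf f ts =>
    let p := flatML vm (o + 1) ts
    (o, (Sum.inr (Sum.inr f), p.1) :: p.2)

def flatML (vm : ℕ → Option ℕ) : ℕ → List XTm → List ℕ × List GNode
  | _, [] => ([], [])
  | o, t :: ts =>
    let a := flatM vm o t
    let b := flatML vm (o + a.2.length) ts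
    (a.1 :: b.1, a.2 ++ b.2)
end

/-- The tree `[t]` of a term `t`. -/
def toGraph (t : XTm) : TG :=
  let ns := (flatM (fun _ => none) 0 t).2
  { n := ns.length
    label := fun v => (ns.getD v (Sum.inl 0, [])).1
    succ := fun v => (ns.getD v (Sum.inl 0, [])).2
    root := 0 }

/-- The node list of the left-hand side tree of a rule. -/
def lhsNodes (ρ : XRule) : List GNode :=
  (flatM (fun _ => none) 0 (XTm.xf ρ.1 (ρ.2.1.map Pat.toX))).2

/-- The right-hand side of a rule, flattened with its variable occurrences
redirected to the (unique, by left-linearity) variable nodes of the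
left-hand side. -/
def rhsFlat (ρ : XRule) : ℕ × List GNode :=
  flatM (fun x => (lhsNodes ρ).findIdx? fun nd => decide (nd.1 = Sum.inl x))
    (lhsNodes ρ).length ρ.2.2

/-- A (call-by-value) homomorphic match of the rule's left-hand side graph in
`G`: labelled rule nodes are mapped label- and successor-preservingly, and
unlabelled (variable) rule nodes are mapped to vertices from which every path
is a constructor path. -/
def GMatch (G : TG) (Lns : List GNode) (φ : ℕ → ℕ) : Prop :=
  ∀ idx < Lns.length,
    φ idx < G.n ∧
    (match (Lns.getD idx (Sum.inl 0, [])).1 with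
     | Sum.inl _ => G.ConPathsFrom (φ idx)
     | Sum.inr s => G.label (φ idx) = Sum.inr s ∧
         G.succ (φ idx) = ((Lns.getD idx (Sum.inl 0, [])).2).map φ)

/-- Resolve a rule-graph reference: left-hand side nodes go through the
match `φ`, right-hand side nodes go to their freshly built copies. -/
def resolveRef (G : TG) (NL : ℕ) (φ : ℕ → ℕ) (ρ : ℕ) : ℕ :=
  if ρ < NL then φ ρ else G.n + (ρ - NL)

/-- The build phase: add a fresh copy of the part of the rule's right-hand
side not contained in its left-hand side. -/
def buildG (G : TG) (NL : ℕ) (φ : ℕ → ℕ) (Rns : List GNode) : TG :=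
  { n := G.n + Rns.length
    label := fun v =>
      if v < G.n then G.label v else (Rns.getD (v - G.n) (Sum.inl 0, [])).1
    succ := fun v =>
      if v < G.n then G.succ v
      else ((Rns.getD (v - G.n) (Sum.inl 0, [])).2).map (resolveRef G NL φ)
    root := G.root }

/-- The redirection phase: all edges (and the root) pointing to `old` now
point to `new`. -/
def redirectG (J : TG) (old new : ℕ) : TG :=
  { n := J.n
    label := J.label
    succ := fun v => (J.succ v).map fun w => if w = old then new else w
    root := if J.root = old then new else J.root }

open Classical in
/-- The garbage-collection phase: vertices not reachable from the root are
removed (cleared). -/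
noncomputable def gcG (K : TG) : TG :=
  { n := K.n
    label := fun v => if K.Reach K.root v then K.label v else Sum.inl 0
    succ := fun v => if K.Reach K.root v then K.succ v else []
    root := K.root }

/-- One step of graph rewriting in the graph rewrite system `[R]` obtained
from the term rules `R`: fire a redex via the build, redirection and
garbage-collection phases. -/
def GRew (R : List XRule) (G I : TG) : Prop :=
  ∃ ρ ∈ R, ∃ φ : ℕ → ℕ,
    GMatch G (lhsNodes ρ) φ ∧
    I = gcG (redirectG
        (buildG G (lhsNodes ρ).length φ (rhsFlat ρ).2)
        (φ 0)
        (resolveRef G (lhsNodes ρ).length φ (rhsFlat ρ).1))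

theorem XTm.forest_induction {P : List XTm → Prop} (nil : P [])
    (var : ∀ x ts, P ts → P (.xv x :: ts))
    (con : ∀ c us ts, P us → P ts → P (.xc c us :: ts))
    (fn : ∀ f us ts, P us → P ts → P (.xf f us :: ts)) : ∀ ts, P ts
  | [] => nil
  | .xv x :: ts => var x ts (XTm.forest_induction nil var con fn ts)
  | .xc c us :: ts => con c us ts (XTm.forest_induction nil var con fn us)
      (XTm.forest_induction nil var con fn ts)
  | .xf f us :: ts => fn f us ts (XTm.forest_induction nil var con fn us)
      (XTm.forest_induction nil var con fn ts)
termination_by ts => sizeOf ts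

/-- A map on terms that commutes with constructors and function symbols. -/
structure XTm.IsHom (F : XTm → XTm) : Prop where
  xc : ∀ c ts, F (.xc c ts) = .xc c (ts.map F)
  xf : ∀ f ts, F (.xf f ts) = .xf f (ts.map F)

theorem XTm.isHom_id : XTm.IsHom id := ⟨by simp, by simp⟩

theorem XTm.isHom_instX (σ : ℕ → CTm) : XTm.IsHom (XTm.instX σ) :=
  ⟨fun c ts => by rw [XTm.instX, List.attach_map_val],
   fun c ts => by rw [XTm.instX, List.attach_map_val]⟩

theorem XTm.instX_xv (σ : ℕ → CTm) (x : ℕ) : XTm.instX σ (.xv x) = CTm.toX (σ x) := by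
  rw [XTm.instX]

theorem XTm.varsX_xc (c : ℕ) (ts : List XTm) :
    XTm.varsX (.xc c ts) = (ts.map XTm.varsX).flatten := by
  rw [XTm.varsX, List.attach_map_val]

theorem XTm.varsX_xf (c : ℕ) (ts : List XTm) :
    XTm.varsX (.xf c ts) = (ts.map XTm.varsX).flatten := by
  rw [XTm.varsX, List.attach_map_val]

theorem XTm.varsX_xv (x : ℕ) : XTm.varsX (.xv x) = [x] := by
  rw [XTm.varsX]

theorem CTm.toX_mk (i : ℕ) (ts : List CTm) :
    CTm.toX (.mk i ts) = .xc i (ts.map CTm.toX) := by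
  rw [CTm.toX, List.attach_map_val]

theorem Pat.toX_pv (x : ℕ) : Pat.toX (.pv x) = .xv x := by
  rw [Pat.toX]

theorem Pat.toX_pc (i : ℕ) (ps : List Pat) :
    Pat.toX (.pc i ps) = .xc i (ps.map Pat.toX) := by
  rw [Pat.toX, List.attach_map_val]

theorem Pat.vars_pv (x : ℕ) : Pat.vars (.pv x) = [x] := by
  rw [Pat.vars]

theorem Pat.vars_pc (i : ℕ) (ps : List Pat) :
    Pat.vars (.pc i ps) = (ps.map Pat.vars).flatten := by
  rw [Pat.vars, List.attach_map_val]

theorem Pat.inst_pv (σ : ℕ → CTm) (x : ℕ) : Pat.inst σ (.pv x) = σ x := by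
  rw [Pat.inst]

theorem Pat.inst_pc (σ : ℕ → CTm) (i : ℕ) (ps : List Pat) :
    Pat.inst σ (.pc i ps) = .mk i (ps.map (Pat.inst σ)) := by
  rw [Pat.inst, List.attach_map_val]

theorem Pat.instX_toX (σ : ℕ → CTm) : ∀ p : Pat,
    XTm.instX σ p.toX = CTm.toX (Pat.inst σ p)
  | .pv x => by rw [Pat.toX_pv, XTm.instX_xv, Pat.inst_pv]
  | .pc i ps => by
    rw [Pat.toX_pc, (XTm.isHom_instX σ).xc, Pat.inst_pc, CTm.toX_mk, List.map_map, List.map_map]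
    congr 1
    exact List.map_congr_left fun p _ => Pat.instX_toX σ p

theorem Pat.varsX_toX : ∀ p : Pat, XTm.varsX p.toX = p.vars
  | .pv x => by rw [Pat.toX_pv, XTm.varsX_xv, Pat.vars_pv]
  | .pc i ps => by
    rw [Pat.toX_pc, XTm.varsX_xc, Pat.vars_pc, List.map_map]
    congr 1
    exact List.map_congr_left fun p _ => Pat.varsX_toX p

theorem CTm.isC_toX : ∀ s : CTm, XTm.IsC s.toX
  | .mk i ts => by
    rw [CTm.toX_mk]
    refine .xc fun t ht => ?_
    obtain ⟨s, hs, rfl⟩ := List.mem_map.1 ht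
    exact CTm.isC_toX s

/-- The left-hand side of a rule as a term. -/
def lhsTm (ρ : XRule) : XTm := .xf ρ.1 (ρ.2.1.map Pat.toX)

theorem instX_lhsTm (σ : ℕ → CTm) (ρ : XRule) :
    XTm.instX σ (lhsTm ρ) = .xf ρ.1 (ρ.2.1.map fun p => CTm.toX (Pat.inst σ p)) := by
  rw [lhsTm, (XTm.isHom_instX σ).xf, List.map_map]
  congr 1
  exact List.map_congr_left fun p _ => Pat.instX_toX σ p

theorem varsX_lhsTm (ρ : XRule) : XTm.varsX (lhsTm ρ) = seqVars ρ.2.1 := by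
  rw [lhsTm, XTm.varsX_xf, List.map_map, seqVars]
  congr 1
  exact List.map_congr_left fun p _ => Pat.varsX_toX p

namespace TG

/-- `Rep G vs ts L`: the vertices `vs` of `G` unfold to the terms `ts`, and the positions
of these terms carrying a function symbol correspond, in preorder, to the vertices `L`. -/
inductive Rep (G : TG) : List ℕ → List XTm → List ℕ → Prop
  | nil : Rep G [] [] []
  | var {v x vs ts L} : v < G.n → G.label v = .inl x → G.succ v = [] →
      Rep G vs ts L → Rep G (v :: vs) (.xv x :: ts) L
  | con {v c us vs ts L₁ L₂} : v < G.n → G.label v = .inr (.inl c) →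
      Rep G (G.succ v) us L₁ → Rep G vs ts L₂ →
      Rep G (v :: vs) (.xc c us :: ts) (L₁ ++ L₂)
  | fn {v f us vs ts L₁ L₂} : v < G.n → G.label v = .inr (.inr f) →
      Rep G (G.succ v) us L₁ → Rep G vs ts L₂ →
      Rep G (v :: vs) (.xf f us :: ts) (v :: (L₁ ++ L₂))

variable {G H K : TG}

theorem Rep.lt {vs ts L} (hr : Rep G vs ts L) : (∀ v ∈ vs, v < G.n) ∧ ∀ v ∈ L, v < G.n := by
  induction hr with
  | nil => simp
  | var => simp_all
  | con => grind
  | fn => grind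

theorem Rep.append {vs ts L vs' ts' L'} (hr : Rep G vs ts L) (hr' : Rep G vs' ts' L') :
    Rep G (vs ++ vs') (ts ++ ts') (L ++ L') := by
  induction hr with
  | nil => exact hr'
  | var h1 h2 h3 _ ih => exact .var h1 h2 h3 ih
  | con h1 h2 h3 _ _ ih => rw [List.append_assoc]; exact .con h1 h2 h3 ih
  | fn h1 h2 h3 _ _ ih =>
    rw [List.cons_append, List.cons_append, List.cons_append, List.append_assoc]
    exact .fn h1 h2 h3 ih

theorem Rep.uncons {v vs t ts L} (hr : Rep G (v :: vs) (t :: ts) L) :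
    ∃ L₁ L₂, Rep G [v] [t] L₁ ∧ Rep G vs ts L₂ ∧ L = L₁ ++ L₂ := by
  cases hr with
  | var h1 h2 h3 h4 => exact ⟨[], _, .var h1 h2 h3 .nil, h4, rfl⟩
  | con h1 h2 h3 h4 => exact ⟨_, _, .con h1 h2 h3 .nil, h4, by simp⟩
  | fn h1 h2 h3 h4 => exact ⟨_, _, .fn h1 h2 h3 .nil, h4, by simp⟩

theorem Rep.unique {vs ts L ts' L'} (hr : Rep G vs ts L) (hr' : Rep G vs ts' L') :
    ts = ts' ∧ L = L' := by
  induction hr generalizing ts' L' with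
  | nil => cases hr'; simp
  | var _ h2 _ _ ih =>
    cases hr' with
    | con _ h => simp_all
    | fn _ h => simp_all
    | var _ h _ h4 =>
      obtain ⟨rfl, rfl⟩ := ih h4
      simp_all
  | con _ h2 _ _ ih1 ih2 =>
    cases hr' with
    | var _ h => simp_all
    | fn _ h => simp_all
    | con _ h h3 h4 =>
      obtain ⟨rfl, rfl⟩ := ih1 h3
      obtain ⟨rfl, rfl⟩ := ih2 h4
      simp_all
  | fn _ h2 _ _ ih1 ih2 =>
    cases hr' with
    | var _ h => simp_all
    | con _ h => simp_all
    | fn _ h h3 h4 =>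
      obtain ⟨rfl, rfl⟩ := ih1 h3
      obtain ⟨rfl, rfl⟩ := ih2 h4
      simp_all

theorem Rep.mem_of_fn {v t L f} (hr : Rep G [v] [t] L) (hv : G.label v = .inr (.inr f)) :
    v ∈ L := by
  cases hr <;> simp_all

theorem Rep.exists_of_mem {vs ts L v} (hr : Rep G vs ts L) (hv : v ∈ vs) :
    ∃ t ∈ ts, ∃ L', Rep G [v] [t] L' ∧ L' ⊆ L := by
  induction vs generalizing ts L with
  | nil => simp at hv
  | cons a vs ih =>
    cases ts with
    | nil => cases hr
    | cons t ts =>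
      obtain ⟨L₁, L₂, h1, h2, rfl⟩ := hr.uncons
      rcases List.mem_cons.1 hv with rfl | hv
      · exact ⟨t, by simp, L₁, h1, by simp⟩
      · obtain ⟨t', ht', L', h, hs⟩ := ih h2 hv
        exact ⟨t', by simp [ht'], L', h, fun x hx => by simp [hs hx]⟩

theorem Rep.edge {v w t L} (hr : Rep G [v] [t] L) (he : G.Edge v w) :
    ∃ t' L', Rep G [w] [t'] L' ∧ L' ⊆ L ∧ (t.IsC → t'.IsC) := by
  cases hr with
  | var h1 h2 h3 => simp [Edge, h3] at he
  | con h1 h2 h3 h4 =>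
    cases h4
    obtain ⟨t', ht', L', h, hs⟩ := h3.exists_of_mem he.2
    exact ⟨t', L', h, by simpa using hs, fun hc => by cases hc with | xc hc => exact hc _ ht'⟩
  | fn h1 h2 h3 h4 =>
    cases h4
    obtain ⟨t', ht', L', h, hs⟩ := h3.exists_of_mem he.2
    exact ⟨t', L', h, fun x hx => by simp [hs hx], fun hc => by cases hc⟩

theorem Rep.reach {v w t L} (hr : Rep G [v] [t] L) (he : G.Reach v w) :
    ∃ t' L', Rep G [w] [t'] L' ∧ L' ⊆ L ∧ (t.IsC → t'.IsC) := by
  induction he with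
  | refl => exact ⟨t, L, hr, by simp, id⟩
  | tail _ e ih =>
    obtain ⟨t', L', h, hs, hc⟩ := ih
    obtain ⟨t'', L'', h', hs', hc'⟩ := h.edge e
    exact ⟨t'', L'', h', fun _ hx => hs (hs' hx), hc' ∘ hc⟩

theorem Rep.conPathsFrom {v t L} (hr : Rep G [v] [t] L) (hc : t.IsC) : G.ConPathsFrom v := by
  intro w hw
  obtain ⟨t', L', h, -, hc'⟩ := hr.reach hw
  cases hc' hc with
  | xc => cases h with | con _ h => exact ⟨_, h⟩

theorem ConPathsFrom.of_mem_succ {v w} (hc : G.ConPathsFrom v) (hv : v < G.n)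
    (hw : w ∈ G.succ v) : G.ConPathsFrom w :=
  fun x hx => hc x (Relation.ReflTransGen.head ⟨hv, hw⟩ hx)

theorem Rep.exists_toX {vs ts L} (hr : Rep G vs ts L) (hc : ∀ v ∈ vs, G.ConPathsFrom v) :
    L = [] ∧ ∃ cs : List CTm, ts = cs.map CTm.toX := by
  induction hr with
  | nil => exact ⟨rfl, [], rfl⟩
  | @var v _ _ _ _ _ h =>
    obtain ⟨c, hc⟩ := hc v (by simp) v .refl
    simp_all
  | @fn v _ _ _ _ _ _ _ h =>
    obtain ⟨c, hc⟩ := hc v (by simp) v .refl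
    simp_all
  | @con v c us vs ts L₁ L₂ h1 _ _ _ ih1 ih2 =>
    obtain ⟨rfl, cs1, rfl⟩ := ih1 fun w hw => (hc v (by simp)).of_mem_succ h1 hw
    obtain ⟨rfl, cs2, rfl⟩ := ih2 fun w hw => hc w (by simp [hw])
    exact ⟨rfl, .mk c cs1 :: cs2, by simp [CTm.toX_mk]⟩

theorem Rep.nil_of_isC {v t L} (hr : Rep G [v] [t] L) (hc : t.IsC) : L = [] :=
  (hr.exists_toX (by simpa using hr.conPathsFrom hc)).1

theorem Rep.congr {vs ts L} (hr : Rep G vs ts L) (hn : G.n = H.n)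
    (hG : ∀ v ∈ vs, ∀ w, G.Reach v w → H.label w = G.label w ∧ H.succ w = G.succ w) :
    Rep H vs ts L := by
  induction hr with
  | nil => exact .nil
  | @var v _ _ _ _ h1 h2 h3 _ ih =>
    obtain ⟨e1, e2⟩ := hG v (by simp) v .refl
    exact .var (hn ▸ h1) (e1.trans h2) (e2.trans h3) (ih fun w hw => hG w (by simp [hw]))
  | @con v _ _ _ _ _ _ h1 h2 _ _ ih1 ih2 =>
    obtain ⟨e1, e2⟩ := hG v (by simp) v .refl
    refine .con (hn ▸ h1) (e1.trans h2) ?_ (ih2 fun w hw => hG w (by simp [hw]))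
    rw [e2]
    exact ih1 fun w hw x hx => hG v (by simp) x (.head ⟨h1, hw⟩ hx)
  | @fn v _ _ _ _ _ _ h1 h2 _ _ ih1 ih2 =>
    obtain ⟨e1, e2⟩ := hG v (by simp) v .refl
    refine .fn (hn ▸ h1) (e1.trans h2) ?_ (ih2 fun w hw => hG w (by simp [hw]))
    rw [e2]
    exact ih1 fun w hw x hx => hG v (by simp) x (.head ⟨h1, hw⟩ hx)

theorem Rep.map_unfoldA {vs ts L} (hr : Rep G vs ts L) (S : Finset ℕ)
    (hS : S ⊆ Finset.range G.n)
    (hanc : ∀ a ∈ S, ∃ s M, Rep G [a] [s] M ∧ ∀ t ∈ ts, sizeOf t < sizeOf s)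
    (k : ℕ) (hk : G.n + 1 ≤ k + S.card) : vs.map (G.unfoldA k) = ts := by
  have hcard : ∀ S : Finset ℕ, S ⊆ Finset.range G.n → S.card ≤ G.n := fun S hS => by
    simpa using Finset.card_le_card hS
  have key : ∀ {v t} {us : List XTm} {S : Finset ℕ} {ts : List XTm} {k L₀},
      S ⊆ Finset.range G.n → Rep G [v] [t] L₀ → (∀ u ∈ us, sizeOf u < sizeOf t) →
      (∀ a ∈ S, ∃ s M, Rep G [a] [s] M ∧ ∀ t' ∈ t :: ts, sizeOf t' < sizeOf s) →
      G.n + 1 ≤ k + 1 + S.card →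
      (insert v S ⊆ Finset.range G.n) ∧
      (∀ a ∈ insert v S, ∃ s M, Rep G [a] [s] M ∧ ∀ t' ∈ us, sizeOf t' < sizeOf s) ∧
      G.n + 1 ≤ k + (insert v S).card := by
    intro v t us S ts k L₀ hS hr hlt hanc hk
    have hvS : v ∉ S := fun hv => by
      obtain ⟨s, M, h, hs⟩ := hanc v hv
      have := (hr.unique h).1
      simp only [List.cons.injEq, and_true] at this
      subst this
      exact lt_irrefl _ (hs t (by simp))
    refine ⟨?_, ?_, ?_⟩
    · refine Finset.insert_subset ?_ hS
      exact Finset.mem_range.2 (hr.lt.1 v (by simp))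
    · intro a ha
      rcases Finset.mem_insert.1 ha with rfl | ha
      · exact ⟨t, _, hr, hlt⟩
      · obtain ⟨s, M, h, hs⟩ := hanc a ha
        exact ⟨s, M, h, fun u hu => (hlt u hu).trans (hs t (by simp))⟩
    · rw [Finset.card_insert_of_notMem hvS]
      omega
  induction hr generalizing S k with
  | nil => rfl
  | var h1 h2 h3 _ ih =>
    have := hcard S hS
    obtain ⟨k, rfl⟩ : ∃ j, k = j + 1 := ⟨k - 1, by omega⟩
    rw [List.map_cons, ih S hS (fun a ha => ?_) _ hk]
    · simp [unfoldA, h2]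
    · obtain ⟨s, M, h, hs⟩ := hanc a ha
      exact ⟨s, M, h, fun t ht => hs t (by simp [ht])⟩
  | @con _ _ us _ _ _ _ h1 h2 h3 _ ih1 ih2 =>
    have := hcard S hS
    obtain ⟨k, rfl⟩ : ∃ j, k = j + 1 := ⟨k - 1, by omega⟩
    obtain ⟨a1, a2, a3⟩ := key (us := us) hS (Rep.con h1 h2 h3 .nil)
      (fun u hu => by have := List.sizeOf_lt_of_mem hu; simp; omega) hanc hk
    rw [List.map_cons, ih2 S hS (fun a ha => ?_) _ hk]
    · simp [unfoldA, h2, ih1 _ a1 a2 _ a3]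
    · obtain ⟨s, M, h, hs⟩ := hanc a ha
      exact ⟨s, M, h, fun t ht => hs t (by simp [ht])⟩
  | @fn _ _ us _ _ _ _ h1 h2 h3 _ ih1 ih2 =>
    have := hcard S hS
    obtain ⟨k, rfl⟩ : ∃ j, k = j + 1 := ⟨k - 1, by omega⟩
    obtain ⟨a1, a2, a3⟩ := key (us := us) hS (Rep.fn h1 h2 h3 .nil)
      (fun u hu => by have := List.sizeOf_lt_of_mem hu; simp; omega) hanc hk
    rw [List.map_cons, ih2 S hS (fun a ha => ?_) _ hk]
    · simp [unfoldA, h2, ih1 _ a1 a2 _ a3]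
    · obtain ⟨s, M, h, hs⟩ := hanc a ha
      exact ⟨s, M, h, fun t ht => hs t (by simp [ht])⟩

theorem Rep.unfold_eq {t L} (hr : Rep G [G.root] [t] L) : G.unfold = t := by
  simpa [unfold] using hr.map_unfoldA ∅ (by simp) (by simp) (G.n + 1) (by simp)

/-- `Ctx G w vs C A B`: the vertices `vs` of `G` unfold to the one-hole context `C`, whose hole
is reached at the vertex `w`; `A` and `B` list the function vertices before and after
the hole. -/
inductive Ctx (G : TG) (w : ℕ) : List ℕ → (XTm → List XTm) → List ℕ → List ℕ → Prop
  | here {vs ts B} : Rep G vs ts B → Ctx G w (w :: vs) (fun s => s :: ts) [] B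
  | tail {v t L vs C A B} : Rep G [v] [t] L → Ctx G w vs C A B →
      Ctx G w (v :: vs) (fun s => t :: C s) (L ++ A) B
  | con {v c vs ts C A B L} : v < G.n → G.label v = .inr (.inl c) →
      Ctx G w (G.succ v) C A B → Rep G vs ts L →
      Ctx G w (v :: vs) (fun s => .xc c (C s) :: ts) A (B ++ L)
  | fn {v f vs ts C A B L} : v < G.n → G.label v = .inr (.inr f) →
      Ctx G w (G.succ v) C A B → Rep G vs ts L →
      Ctx G w (v :: vs) (fun s => .xf f (C s) :: ts) (v :: A) (B ++ L)

theorem Ctx.fill {w vs C A B s L} (hC : Ctx G w vs C A B) (hs : Rep G [w] [s] L) :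
    Rep G vs (C s) (A ++ L ++ B) := by
  induction hC with
  | here h => simpa using hs.append h
  | tail h _ ih => simpa using h.append ih
  | con h1 h2 _ h3 ih => simpa using Rep.con h1 h2 ih h3
  | fn h1 h2 _ h3 ih => simpa using Rep.fn h1 h2 ih h3

theorem Ctx.append {w vs C A B vs' ts' L} (hC : Ctx G w vs C A B) (hr : Rep G vs' ts' L) :
    Ctx G w (vs ++ vs') (fun s => C s ++ ts') A (B ++ L) := by
  induction hC with
  | here h => exact .here (h.append hr)
  | tail h _ ih => exact .tail h ih
  | con h1 h2 h3 h4 _ => rw [List.append_assoc]; exact .con h1 h2 h3 (h4.append hr)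
  | fn h1 h2 h3 h4 _ => rw [List.append_assoc]; exact .fn h1 h2 h3 (h4.append hr)

theorem Ctx.xRew {R : List XRule} {w vs C A B s s'} (hC : Ctx G w vs C A B)
    (hs : XRew R s s') :
    ∃ l t t' r, C s = l ++ t :: r ∧ C s' = l ++ t' :: r ∧ XRew R t t' := by
  induction hC with
  | @here _ ts => exact ⟨[], s, s', ts, rfl, rfl, hs⟩
  | @tail _ t _ _ _ _ _ _ _ ih =>
    obtain ⟨l, a, a', r, e, e', ha⟩ := ih
    exact ⟨t :: l, a, a', r, by simp [e], by simp [e'], ha⟩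
  | con _ _ _ _ ih =>
    obtain ⟨l, a, a', r, e, e', ha⟩ := ih
    exact ⟨[], _, _, _, rfl, rfl, by rw [e, e']; exact .congC ha⟩
  | fn _ _ _ _ ih =>
    obtain ⟨l, a, a', r, e, e', ha⟩ := ih
    exact ⟨[], _, _, _, rfl, rfl, by rw [e, e']; exact .congF ha⟩

theorem Rep.exists_ctx {vs ts L w} (hr : Rep G vs ts L) (hw : w ∈ L) :
    ∃ C A B s Ls, Ctx G w vs C A B ∧ Rep G [w] [s] Ls ∧ ts = C s := by
  induction hr with
  | nil => simp at hw
  | var h1 h2 h3 _ ih =>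
    obtain ⟨C, A, B, s, Ls, hC, hs, rfl⟩ := ih hw
    exact ⟨_, _, _, s, Ls, .tail (.var h1 h2 h3 .nil) hC, hs, rfl⟩
  | con h1 h2 h3 h4 ih1 ih2 =>
    rcases List.mem_append.1 hw with hw | hw
    · obtain ⟨C, A, B, s, Ls, hC, hs, rfl⟩ := ih1 hw
      exact ⟨_, _, _, s, Ls, .con h1 h2 hC h4, hs, rfl⟩
    · obtain ⟨C, A, B, s, Ls, hC, hs, rfl⟩ := ih2 hw
      exact ⟨_, _, _, s, Ls, .tail (.con h1 h2 h3 .nil) hC, hs, rfl⟩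
  | fn h1 h2 h3 h4 ih1 ih2 =>
    rcases List.mem_cons.1 hw with rfl | hw
    · exact ⟨_, _, _, _, _, .here h4, .fn h1 h2 h3 .nil, rfl⟩
    rcases List.mem_append.1 hw with hw | hw
    · obtain ⟨C, A, B, s, Ls, hC, hs, rfl⟩ := ih1 hw
      exact ⟨_, _, _, s, Ls, .fn h1 h2 hC h4, hs, rfl⟩
    · obtain ⟨C, A, B, s, Ls, hC, hs, rfl⟩ := ih2 hw
      exact ⟨_, _, _, s, Ls, .tail (.fn h1 h2 h3 .nil) hC, hs, rfl⟩

theorem Rep.exists_ctx_append {s s' t t' : XTm}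
    (ih : ∀ {v L}, Rep G [v] [t] L → ∃ w C A B Ls, Ctx G w [v] C A B ∧
      Rep G [w] [s] Ls ∧ [t] = C s ∧ [t'] = C s')
    {r : List XTm} : ∀ {l : List XTm} {vs L}, Rep G vs (l ++ t :: r) L →
      ∃ w C A B Ls, Ctx G w vs C A B ∧
        Rep G [w] [s] Ls ∧ l ++ t :: r = C s ∧ l ++ t' :: r = C s'
  | [], [], _, hr => by cases hr
  | [], v :: vs, _, hr => by
    obtain ⟨L₁, L₂, h1, h2, rfl⟩ := hr.uncons
    obtain ⟨w, C, A, B, Ls, hC, hs, e, e'⟩ := ih h1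
    exact ⟨w, _, _, _, Ls, hC.append h2, hs, by simp [← e], by simp [← e']⟩
  | a :: l, [], _, hr => by cases hr
  | a :: l, v :: vs, _, hr => by
    obtain ⟨L₁, L₂, h1, h2, rfl⟩ := hr.uncons
    obtain ⟨w, C, A, B, Ls, hC, hs, e, e'⟩ := Rep.exists_ctx_append ih h2
    exact ⟨w, _, _, _, Ls, .tail h1 hC, hs, by simp [← e], by simp [← e']⟩

theorem Rep.exists_redex {R : List XRule} {t t'} (hx : XRew R t t') :
    ∃ ρ ∈ R, ∃ σ, ∀ {v L}, Rep G [v] [t] L → ∃ w C A B Ls, Ctx G w [v] C A B ∧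
      Rep G [w] [XTm.instX σ (lhsTm ρ)] Ls ∧
      [t] = C (XTm.instX σ (lhsTm ρ)) ∧ [t'] = C (XTm.instX σ ρ.2.2) := by
  induction hx with
  | @root f ps r σ hρ =>
    refine ⟨_, hρ, σ, fun {v L} hr => ?_⟩
    have e := instX_lhsTm σ (f, ps, r)
    rw [e]
    exact ⟨v, _, _, _, L, .here .nil, hr, rfl, rfl⟩
  | congC _ ih =>
    obtain ⟨ρ, hρ, σ, ih⟩ := ih
    refine ⟨ρ, hρ, σ, fun {v L} hr => ?_⟩
    cases hr with
    | con h1 h2 h3 h4 =>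
      obtain ⟨w, C, A, B, Ls, hC, hs, e, e'⟩ := Rep.exists_ctx_append ih h3
      cases h4
      exact ⟨w, _, _, _, Ls, .con h1 h2 hC .nil, hs, by simp [← e], by simp [← e']⟩
  | congF _ ih =>
    obtain ⟨ρ, hρ, σ, ih⟩ := ih
    refine ⟨ρ, hρ, σ, fun {v L} hr => ?_⟩
    cases hr with
    | fn h1 h2 h3 h4 =>
      obtain ⟨w, C, A, B, Ls, hC, hs, e, e'⟩ := Rep.exists_ctx_append ih h3
      cases h4
      exact ⟨w, _, _, _, Ls, .fn h1 h2 hC .nil, hs, by simp [← e], by simp [← e']⟩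

/-- `K` restricted to the vertices of `G` is `G` with the edges into `w` redirected to `w'`. -/
structure IsRedirect (G K : TG) (w w' : ℕ) : Prop where
  le : G.n ≤ K.n
  label : ∀ v < G.n, K.label v = G.label v
  succ : ∀ v < G.n, K.succ v = (G.succ v).map fun x => if x = w then w' else x

theorem IsRedirect.rep {w w' vs ts L f} (hK : IsRedirect G K w w')
    (hw : G.label w = .inr (.inr f)) (hr : Rep G vs ts L) (hL : w ∉ L) :
    Rep K (vs.map fun x => if x = w then w' else x) ts L := by
  induction hr with
  | nil => exact .nil
  | @var v _ _ _ _ h1 h2 h3 _ ih =>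
    have hv : v ≠ w := by rintro rfl; simp_all
    rw [List.map_cons, if_neg hv]
    exact .var (h1.trans_le hK.le) ((hK.label v h1).trans h2) (by rw [hK.succ v h1, h3]; rfl)
      (ih hL)
  | @con v _ _ _ _ _ _ h1 h2 _ _ ih1 ih2 =>
    have hv : v ≠ w := by rintro rfl; simp_all
    simp only [List.mem_append, not_or] at hL
    rw [List.map_cons, if_neg hv]
    refine .con (h1.trans_le hK.le) ((hK.label v h1).trans h2) ?_ (ih2 hL.2)
    rw [hK.succ v h1]
    exact ih1 hL.1
  | @fn v _ _ _ _ _ _ h1 h2 _ _ ih1 ih2 =>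
    simp only [List.mem_cons, List.mem_append, not_or] at hL
    rw [List.map_cons, if_neg (Ne.symm hL.1)]
    refine .fn (h1.trans_le hK.le) ((hK.label v h1).trans h2) ?_ (ih2 hL.2.2)
    rw [hK.succ v h1]
    exact ih1 hL.2.1

theorem IsRedirect.ctx {w w' vs C A B f} (hK : IsRedirect G K w w')
    (hw : G.label w = .inr (.inr f)) (hC : Ctx G w vs C A B) (hA : w ∉ A) (hB : w ∉ B) :
    Ctx K w' (vs.map fun x => if x = w then w' else x) C A B := by
  induction hC with
  | here h =>
    rw [List.map_cons, if_pos rfl]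
    exact .here (hK.rep hw h hB)
  | tail h _ ih =>
    simp only [List.mem_append, not_or] at hA
    exact .tail (hK.rep hw h hA.1) (ih hA.2 hB)
  | @con v _ _ _ _ _ _ _ h1 h2 _ h3 ih =>
    have hv : v ≠ w := by rintro rfl; simp_all
    simp only [List.mem_append, not_or] at hB
    rw [List.map_cons, if_neg hv]
    refine .con (h1.trans_le hK.le) ((hK.label v h1).trans h2) ?_ (hK.rep hw h3 hB.2)
    rw [hK.succ v h1]
    exact ih hA hB.1
  | @fn v _ _ _ _ _ _ _ h1 h2 _ h3 ih =>
    simp only [List.mem_append, List.mem_cons, not_or] at hA hB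
    rw [List.map_cons, if_neg (Ne.symm hA.1)]
    refine .fn (h1.trans_le hK.le) ((hK.label v h1).trans h2) ?_ (hK.rep hw h3 hB.2)
    rw [hK.succ v h1]
    exact ih hA.2 hB.1

/-- The vertex `ψ k` of `G` is an instance of the node `nd`, where variables of the node are
instantiated according to `F`. -/
def NodeInst (G : TG) (F : XTm → XTm) (ψ : ℕ → ℕ) (k : ℕ) (nd : GNode) : Prop :=
  (∀ x, nd.1 = .inl x → Rep G [ψ k] [F (.xv x)] []) ∧
  (∀ s, nd.1 = .inr s → ψ k < G.n ∧ G.label (ψ k) = .inr s ∧ G.succ (ψ k) = nd.2.map ψ)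

/-- The nodes of a list numbered from `o` on are instantiated in `G` along `ψ`. -/
def NodesInst (G : TG) (F : XTm → XTm) (ψ : ℕ → ℕ) (o : ℕ) (ns : List GNode) : Prop :=
  ∀ i nd, ns[i]? = some nd → NodeInst G F ψ (o + i) nd

theorem nodesInst_cons {F ψ o nd ns} : NodesInst G F ψ o (nd :: ns) ↔
    NodeInst G F ψ o nd ∧ NodesInst G F ψ (o + 1) ns := by
  constructor
  · intro h
    refine ⟨h 0 nd rfl, fun i nd' hi => ?_⟩
    have := h (i + 1) nd' (by simpa using hi)
    rwa [show o + (i + 1) = o + 1 + i by omega] at this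
  · rintro ⟨h1, h2⟩ (_ | i) nd' hi
    · simp only [List.getElem?_cons_zero, Option.some.injEq] at hi
      exact hi ▸ h1
    · have := h2 i nd' (by simpa using hi)
      rwa [show o + (i + 1) = o + 1 + i by omega]

theorem nodesInst_append {F ψ o ns ns'} : NodesInst G F ψ o (ns ++ ns') ↔
    NodesInst G F ψ o ns ∧ NodesInst G F ψ (o + ns.length) ns' := by
  induction ns generalizing o with
  | nil => simp [NodesInst]
  | cons nd ns ih =>
    rw [List.cons_append, nodesInst_cons, nodesInst_cons, ih, and_assoc, List.length_cons,
      show o + 1 + ns.length = o + (ns.length + 1) by omega]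

theorem flatML_xv_some {vm : ℕ → Option ℕ} {o x i ts} (hx : vm x = some i) :
    flatML vm o (.xv x :: ts) = (i :: (flatML vm o ts).1, (flatML vm o ts).2) := by
  simp [flatML, flatM, hx]

theorem flatML_xv_none {vm : ℕ → Option ℕ} {o x ts} (hx : vm x = none) :
    flatML vm o (.xv x :: ts) =
      (o :: (flatML vm (o + 1) ts).1, (.inl x, []) :: (flatML vm (o + 1) ts).2) := by
  simp [flatML, flatM, hx]

theorem flatML_xc {vm : ℕ → Option ℕ} {o c us ts} :
    flatML vm o (.xc c us :: ts) =
      (o :: (flatML vm (o + 1 + (flatML vm (o + 1) us).2.length) ts).1,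
        (.inr (.inl c), (flatML vm (o + 1) us).1) :: ((flatML vm (o + 1) us).2 ++
          (flatML vm (o + 1 + (flatML vm (o + 1) us).2.length) ts).2)) := by
  simp [flatML, flatM, Nat.add_assoc, Nat.add_comm]

theorem flatML_xf {vm : ℕ → Option ℕ} {o f us ts} :
    flatML vm o (.xf f us :: ts) =
      (o :: (flatML vm (o + 1 + (flatML vm (o + 1) us).2.length) ts).1,
        (.inr (.inr f), (flatML vm (o + 1) us).1) :: ((flatML vm (o + 1) us).2 ++
          (flatML vm (o + 1 + (flatML vm (o + 1) us).2.length) ts).2)) := by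
  simp [flatML, flatM, Nat.add_assoc, Nat.add_comm]

theorem flatML_singleton {vm : ℕ → Option ℕ} {o t} :
    flatML vm o [t] = ([(flatM vm o t).1], (flatM vm o t).2) := by
  simp [flatML]

/-- The variable of an unlabelled node. -/
def nodeVar (nd : GNode) : Option ℕ := nd.1.elim some fun _ => none

theorem nodeVar_eq_some {nd : GNode} {x : ℕ} : nodeVar nd = some x ↔ nd.1 = .inl x := by
  obtain ⟨_ | _, _⟩ := nd <;> simp [nodeVar]

theorem filterMap_nodeVar_flatML (vm : ℕ → Option ℕ) (ts : List XTm) : ∀ o,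
    (flatML vm o ts).2.filterMap nodeVar =
      (ts.map XTm.varsX).flatten.filter fun x => (vm x).isNone := by
  induction ts using XTm.forest_induction with
  | nil => simp [flatML]
  | var x ts ih =>
    intro o
    cases hx : vm x with
    | none => simp [flatML_xv_none hx, XTm.varsX_xv, hx, ih, nodeVar]
    | some i => simp [flatML_xv_some hx, XTm.varsX_xv, hx, ih]
  | con c us ts ih1 ih2 =>
    intro o
    rw [flatML_xc, List.filterMap_cons_none rfl, List.filterMap_append, ih1, ih2]
    simp [XTm.varsX_xc]
  | fn f us ts ih1 ih2 =>
    intro o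
    rw [flatML_xf, List.filterMap_cons_none rfl, List.filterMap_append, ih1, ih2]
    simp [XTm.varsX_xf]

theorem NodesInst.rep_flatML {F : XTm → XTm} (hF : XTm.IsHom F) {ψ : ℕ → ℕ}
    {vm : ℕ → Option ℕ} (ts : List XTm) : ∀ o,
    (∀ x ∈ (ts.map XTm.varsX).flatten, ∀ i, vm x = some i → Rep G [ψ i] [F (.xv x)] []) →
    NodesInst G F ψ o (flatML vm o ts).2 →
    ∃ L, Rep G ((flatML vm o ts).1.map ψ) (ts.map F) L ∧
      L.Sublist ((List.range' o (flatML vm o ts).2.length).map ψ) ∧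
      ∀ i < (flatML vm o ts).2.length, ∃ t' L', Rep G [ψ (o + i)] [t'] L' ∧ L' ⊆ L := by
  induction ts using XTm.forest_induction with
  | nil => intro o _ _; exact ⟨[], by simpa [flatML] using .nil, by simp, by simp [flatML]⟩
  | var x ts ih =>
    intro o hvm hns
    cases hx : vm x with
    | none =>
      rw [flatML_xv_none hx] at hns ⊢
      obtain ⟨hnd, hns⟩ := nodesInst_cons.1 hns
      obtain ⟨L, h1, h2, h3⟩ := ih (o + 1) (fun y hy => hvm y (by simp [hy])) hns
      have hr := hnd.1 x rfl
      refine ⟨L, by simpa using hr.append h1, ?_, ?_⟩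
      · rw [List.length_cons, List.range'_succ, List.map_cons]
        exact h2.cons _
      · rintro (_ | i) hi
        · exact ⟨_, _, hr, by simp⟩
        · have := h3 i (by simpa using hi)
          rwa [show o + (i + 1) = o + 1 + i by omega]
    | some i =>
      rw [flatML_xv_some hx] at hns ⊢
      obtain ⟨L, h1, h2, h3⟩ := ih o (fun y hy => hvm y (by simp [hy])) hns
      have hr := hvm x (by simp [XTm.varsX_xv]) i hx
      exact ⟨L, by simpa using hr.append h1, h2, h3⟩
  | con c us ts ih1 ih2 =>
    intro o hvm hns
    rw [flatML_xc] at hns ⊢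
    obtain ⟨hnd, hns⟩ := nodesInst_cons.1 hns
    obtain ⟨hns1, hns2⟩ := nodesInst_append.1 hns
    obtain ⟨L₁, a1, a2, a3⟩ := ih1 (o + 1)
      (fun y hy => hvm y (by
        rw [List.map_cons, List.flatten_cons, XTm.varsX_xc]
        exact List.mem_append_left _ hy)) hns1
    obtain ⟨L₂, b1, b2, b3⟩ := ih2 _ (fun y hy => hvm y (by
        rw [List.map_cons, List.flatten_cons]
        exact List.mem_append_right _ hy)) hns2
    obtain ⟨c1, c2, c3⟩ := hnd.2 _ rfl
    rw [← c3] at a1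
    refine ⟨L₁ ++ L₂, ?_, ?_, ?_⟩
    · rw [List.map_cons, List.map_cons, hF.xc]
      exact .con c1 c2 a1 b1
    · rw [List.length_cons, List.range'_succ, List.map_cons, List.length_append,
        ← List.range'_append_1, List.map_append]
      exact (a2.append b2).cons _
    · rintro (_ | i) hi
      · exact ⟨_, _, .con c1 c2 a1 .nil, by simp⟩
      · rw [List.length_cons, List.length_append] at hi
        by_cases hi' : i < (flatML vm (o + 1) us).2.length
        · obtain ⟨t', L', h, hs⟩ := a3 i hi'
          rw [show o + 1 + i = o + (i + 1) by omega] at h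
          exact ⟨t', L', h, fun x hx => by simp [hs hx]⟩
        · obtain ⟨t', L', h, hs⟩ := b3 (i - (flatML vm (o + 1) us).2.length) (by omega)
          rw [show o + 1 + (flatML vm (o + 1) us).2.length +
            (i - (flatML vm (o + 1) us).2.length) = o + (i + 1) by omega] at h
          exact ⟨t', L', h, fun x hx => by simp [hs hx]⟩
  | fn c us ts ih1 ih2 =>
    intro o hvm hns
    rw [flatML_xf] at hns ⊢
    obtain ⟨hnd, hns⟩ := nodesInst_cons.1 hns
    obtain ⟨hns1, hns2⟩ := nodesInst_append.1 hns
    obtain ⟨L₁, a1, a2, a3⟩ := ih1 (o + 1)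
      (fun y hy => hvm y (by
        rw [List.map_cons, List.flatten_cons, XTm.varsX_xf]
        exact List.mem_append_left _ hy)) hns1
    obtain ⟨L₂, b1, b2, b3⟩ := ih2 _ (fun y hy => hvm y (by
        rw [List.map_cons, List.flatten_cons]
        exact List.mem_append_right _ hy)) hns2
    obtain ⟨c1, c2, c3⟩ := hnd.2 _ rfl
    rw [← c3] at a1
    refine ⟨ψ o :: (L₁ ++ L₂), ?_, ?_, ?_⟩
    · rw [List.map_cons, List.map_cons, hF.xf]
      exact .fn c1 c2 a1 b1
    · rw [List.length_cons, List.range'_succ, List.map_cons, List.length_append,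
        ← List.range'_append_1, List.map_append]
      exact (a2.append b2).cons_cons _
    · rintro (_ | i) hi
      · exact ⟨_, _, .fn c1 c2 a1 .nil, by simp⟩
      · rw [List.length_cons, List.length_append] at hi
        by_cases hi' : i < (flatML vm (o + 1) us).2.length
        · obtain ⟨t', L', h, hs⟩ := a3 i hi'
          rw [show o + 1 + i = o + (i + 1) by omega] at h
          exact ⟨t', L', h, fun x hx => by simp [hs hx]⟩
        · obtain ⟨t', L', h, hs⟩ := b3 (i - (flatML vm (o + 1) us).2.length) (by omega)
          rw [show o + 1 + (flatML vm (o + 1) us).2.length +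
            (i - (flatML vm (o + 1) us).2.length) = o + (i + 1) by omega] at h
          exact ⟨t', L', h, fun x hx => by simp [hs hx]⟩

theorem flatML_refs_lt (ts : List XTm) : ∀ o,
    (∀ r ∈ (flatML (fun _ => none) o ts).1,
      o ≤ r ∧ r < o + (flatML (fun _ => none) o ts).2.length) ∧
    ∀ nd ∈ (flatML (fun _ => none) o ts).2, ∀ r ∈ nd.2,
      o ≤ r ∧ r < o + (flatML (fun _ => none) o ts).2.length := by
  induction ts using XTm.forest_induction with
  | nil => simp [flatML]
  | var x ts ih =>
    intro o
    rw [flatML_xv_none rfl]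
    obtain ⟨a, b⟩ := ih (o + 1)
    simp only [List.forall_mem_cons, List.length_cons]
    exact ⟨⟨by omega, fun r hr => by have := a r hr; omega⟩, by simp,
      fun nd hnd r hr => by have := b nd hnd r hr; omega⟩
  | con c us ts ih1 ih2 =>
    intro o
    rw [flatML_xc]
    obtain ⟨a, b⟩ := ih1 (o + 1)
    obtain ⟨a', b'⟩ := ih2 (o + 1 + (flatML (fun _ => none) (o + 1) us).2.length)
    simp only [List.forall_mem_cons, List.forall_mem_append, List.length_cons, List.length_append]
    exact ⟨⟨by omega, fun r hr => by have := a' r hr; omega⟩,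
      fun r hr => by have := a r hr; omega, fun nd hnd r hr => by have := b nd hnd r hr; omega,
      fun nd hnd r hr => by have := b' nd hnd r hr; omega⟩
  | fn c us ts ih1 ih2 =>
    intro o
    rw [flatML_xf]
    obtain ⟨a, b⟩ := ih1 (o + 1)
    obtain ⟨a', b'⟩ := ih2 (o + 1 + (flatML (fun _ => none) (o + 1) us).2.length)
    simp only [List.forall_mem_cons, List.forall_mem_append, List.length_cons, List.length_append]
    exact ⟨⟨by omega, fun r hr => by have := a' r hr; omega⟩,
      fun r hr => by have := a r hr; omega, fun nd hnd r hr => by have := b nd hnd r hr; omega,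
      fun nd hnd r hr => by have := b' nd hnd r hr; omega⟩

theorem NodesInst.congr {F ψ ψ' o ns} (h : NodesInst G F ψ o ns)
    (hrefs : ∀ nd ∈ ns, ∀ r ∈ nd.2, ψ' r = ψ r)
    (hidx : ∀ i < ns.length, ψ' (o + i) = ψ (o + i)) : NodesInst G F ψ' o ns := by
  intro i nd hi
  have hlt : i < ns.length := (List.getElem?_eq_some_iff.1 hi).1
  have hmem : nd ∈ ns := List.mem_of_getElem? hi
  obtain ⟨h1, h2⟩ := h i nd hi
  refine ⟨by rwa [hidx i hlt], ?_⟩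
  rw [hidx i hlt, List.map_congr_left (hrefs nd hmem)]
  exact h2

theorem NodesInst.glue {F ψ₁ ψ₂ o us ts}
    (h₁ : NodesInst G F ψ₁ o (flatML (fun _ => none) o us).2)
    (h₂ : NodesInst G F ψ₂ (o + (flatML (fun _ => none) o us).2.length)
      (flatML (fun _ => none) (o + (flatML (fun _ => none) o us).2.length) ts).2) :
    ∃ ψ, NodesInst G F ψ o ((flatML (fun _ => none) o us).2 ++
      (flatML (fun _ => none) (o + (flatML (fun _ => none) o us).2.length) ts).2) ∧
      (∀ k < o + (flatML (fun _ => none) o us).2.length, ψ k = ψ₁ k) ∧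
      ∀ k, o + (flatML (fun _ => none) o us).2.length ≤ k → ψ k = ψ₂ k := by
  obtain ⟨-, a⟩ := flatML_refs_lt us o
  obtain ⟨-, b⟩ := flatML_refs_lt ts (o + (flatML (fun _ => none) o us).2.length)
  refine ⟨fun k => if k < o + (flatML (fun _ => none) o us).2.length then ψ₁ k else ψ₂ k,
    nodesInst_append.2 ⟨h₁.congr ?_ ?_, h₂.congr ?_ ?_⟩, ?_, ?_⟩
  · intro nd hnd r hr
    simp [(a nd hnd r hr).2]
  · intro i hi
    simp [hi]
  · intro nd hnd r hr
    simp [(b nd hnd r hr).1]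
  · intro i hi
    simp
  · intro k hk
    simp [hk]
  · intro k hk
    simp [hk]

theorem NodesInst.exists_cons {F ψ k nd o us ts} {vs' : List ℕ}
    (hus : NodesInst G F ψ (o + 1) (flatML (fun _ => none) (o + 1) us).2)
    (hvs : ∃ ψ₂, (flatML (fun _ => none)
        (o + 1 + (flatML (fun _ => none) (o + 1) us).2.length) ts).1.map ψ₂ = vs' ∧
      NodesInst G F ψ₂ (o + 1 + (flatML (fun _ => none) (o + 1) us).2.length)
        (flatML (fun _ => none)
          (o + 1 + (flatML (fun _ => none) (o + 1) us).2.length) ts).2)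
    (hnd : ∀ ψ' : ℕ → ℕ, ψ' o = k → (∀ r ∈ (flatML (fun _ => none) (o + 1) us).1, ψ' r = ψ r) →
      NodeInst G F ψ' o nd) :
    ∃ ψ', (o :: (flatML (fun _ => none)
        (o + 1 + (flatML (fun _ => none) (o + 1) us).2.length) ts).1).map ψ' = k :: vs' ∧
      NodesInst G F ψ' o (nd :: ((flatML (fun _ => none) (o + 1) us).2 ++
        (flatML (fun _ => none)
          (o + 1 + (flatML (fun _ => none) (o + 1) us).2.length) ts).2)) := by
  obtain ⟨ψ₂, hm, h₂⟩ := hvs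
  obtain ⟨χ, h, e1, e2⟩ := hus.glue h₂
  obtain ⟨a1, a2⟩ := flatML_refs_lt us (o + 1)
  obtain ⟨b1, b2⟩ := flatML_refs_lt ts (o + 1 + (flatML (fun _ => none) (o + 1) us).2.length)
  refine ⟨fun i => if i = o then k else χ i, ?_, nodesInst_cons.2 ⟨hnd _ (by simp) ?_, ?_⟩⟩
  · rw [List.map_cons, if_pos rfl, ← hm]
    congr 1
    refine List.map_congr_left fun r hr => ?_
    have := b1 r hr
    rw [if_neg (by omega), e2 r this.1]
  · intro r hr
    have := a1 r hr
    rw [if_neg (by omega), e1 r this.2]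
  · refine h.congr ?_ ?_
    · intro nd hnd r hr
      rcases List.mem_append.1 hnd with hnd | hnd
      · have := a2 nd hnd r hr
        exact if_neg (by omega)
      · have := b2 nd hnd r hr
        exact if_neg (by omega)
    · intro i _
      exact if_neg (by omega)

theorem Rep.exists_nodesInst {F : XTm → XTm} (hF : XTm.IsHom F)
    (hvar : ∀ {v x L}, Rep G [v] [F (.xv x)] L → L = []) (ts : List XTm) : ∀ {vs L o},
    Rep G vs (ts.map F) L →
    ∃ ψ, (flatML (fun _ => none) o ts).1.map ψ = vs ∧
      NodesInst G F ψ o (flatML (fun _ => none) o ts).2 := by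
  induction ts using XTm.forest_induction with
  | nil => intro vs L o hr; cases hr; exact ⟨id, by simp [flatML], by simp [flatML, NodesInst]⟩
  | var x ts ih =>
    intro vs L o hr
    cases vs with
    | nil => cases hr
    | cons v vs =>
      obtain ⟨L₁, L₂, h1, h2, rfl⟩ := hr.uncons
      obtain rfl := hvar h1
      rw [flatML_xv_none rfl]
      have := NodesInst.exists_cons (G := G) (F := F) (ψ := id) (k := v) (nd := (.inl x, []))
        (o := o) (us := []) (ts := ts) (vs' := vs) (by simp [flatML, NodesInst])
        (by simpa [flatML] using ih h2)
        (fun ψ' hψ _ => ⟨fun y hy => by cases hy; rwa [hψ], fun s hs => by cases hs⟩)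
      simpa [flatML] using this
  | con c us ts ih1 ih2 =>
    intro vs L o hr
    rw [List.map_cons, hF.xc] at hr
    cases hr with
    | con h1 h2 h3 h4 =>
      rw [flatML_xc]
      obtain ⟨ψ, hm, hψ⟩ := ih1 (o := o + 1) h3
      refine NodesInst.exists_cons hψ (ih2 h4) (fun ψ' e hr => ⟨fun y hy => ?_, fun s hs => ?_⟩)
      · cases hy
      · cases hs
        rw [e]
        exact ⟨h1, h2, by rw [← hm]; exact (List.map_congr_left hr).symm⟩
  | fn c us ts ih1 ih2 =>
    intro vs L o hr
    rw [List.map_cons, hF.xf] at hr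
    cases hr with
    | fn h1 h2 h3 h4 =>
      rw [flatML_xf]
      obtain ⟨ψ, hm, hψ⟩ := ih1 (o := o + 1) h3
      refine NodesInst.exists_cons hψ (ih2 h4) (fun ψ' e hr => ⟨fun y hy => ?_, fun s hs => ?_⟩)
      · cases hy
      · cases hs
        rw [e]
        exact ⟨h1, h2, by rw [← hm]; exact (List.map_congr_left hr).symm⟩

/-- The simulation invariant: `G` unfolds to `t` without sharing function vertices, has no
function vertices besides those reachable from the root, and is acyclic. -/
structure Represents (G : TG) (t : XTm) : Prop where
  root : ∃ L, Rep G [G.root] [t] L ∧ L.Nodup ∧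
    ∀ v < G.n, ∀ f, G.label v = .inr (.inr f) → v ∈ L
  total : ∀ v < G.n, ∃ t' L', Rep G [v] [t'] L'

theorem Rep.represents_gcG {t L} (hr : Rep K [K.root] [t] L) (hL : L.Nodup) :
    Represents (gcG K) t := by
  have hag : ∀ v, K.Reach K.root v → ∀ w, K.Reach v w →
      (gcG K).label w = K.label w ∧ (gcG K).succ w = K.succ w := by
    intro v hv w hw
    simp [gcG, show K.Reach K.root w from Relation.ReflTransGen.trans hv hw]
  refine ⟨⟨L, hr.congr rfl fun v hv => ?_, hL, fun v hv f hf => ?_⟩, fun v hv => ?_⟩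
  · rw [List.mem_singleton] at hv
    subst hv
    exact hag _ .refl
  · by_cases hreach : K.Reach K.root v
    · simp only [gcG, if_pos hreach] at hf
      obtain ⟨t', L', h, hs, -⟩ := hr.reach hreach
      exact hs (h.mem_of_fn hf)
    · simp [gcG, hreach] at hf
  · by_cases hreach : K.Reach K.root v
    · obtain ⟨t', L', h, -⟩ := hr.reach hreach
      exact ⟨t', L', h.congr rfl fun w hw => by
        simp only [List.mem_singleton] at hw; subst hw; exact hag _ hreach⟩
    · exact ⟨.xv 0, [], .var hv (by simp [gcG, hreach]) (by simp [gcG, hreach]) .nil⟩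

theorem flatML_inl_succ (vm : ℕ → Option ℕ) (ts : List XTm) : ∀ o,
    ∀ nd ∈ (flatML vm o ts).2, ∀ x, nd.1 = .inl x → nd.2 = [] := by
  induction ts using XTm.forest_induction with
  | nil => simp [flatML]
  | var x ts ih =>
    intro o
    cases hx : vm x with
    | none => rw [flatML_xv_none hx]; grind
    | some i => rw [flatML_xv_some hx]; grind
  | con c us ts ih1 ih2 => intro o; rw [flatML_xc]; grind
  | fn f us ts ih1 ih2 => intro o; rw [flatML_xf]; grind

theorem flatM_none_fst (o : ℕ) (t : XTm) : (flatM (fun _ => none) o t).1 = o := by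
  cases t <;> simp [flatM]

theorem represents_toGraph (t : XTm) : Represents (toGraph t) t := by
  obtain ⟨L, h1, h2, h3⟩ := NodesInst.rep_flatML (G := toGraph t) XTm.isHom_id (ψ := id)
    (vm := fun _ => none) [t] 0 (by simp) (by
      intro i nd hi
      have hsucc := flatML_inl_succ (fun _ => none) [t] 0 nd (List.mem_of_getElem? hi)
      rw [flatML_singleton] at hi
      have hlt : i < (toGraph t).n := (List.getElem?_eq_some_iff.1 hi).1
      have hl : (toGraph t).label i = nd.1 := by simp [toGraph, hi]
      have hs : (toGraph t).succ i = nd.2 := by simp [toGraph, hi]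
      rw [Nat.zero_add]
      exact ⟨fun x hx => .var hlt (hl.trans hx) (hs.trans (hsucc x hx)) .nil,
        fun s hs' => ⟨hlt, hl.trans hs', by simpa using hs⟩⟩)
  simp only [flatML_singleton, flatM_none_fst, List.map_id, id_eq, Nat.zero_add] at h1 h2 h3
  refine ⟨⟨L, h1, h2.nodup List.nodup_range', fun v hv f hf => ?_⟩, fun v hv => ?_⟩
  · obtain ⟨t', L', h, hs⟩ := h3 v hv
    exact hs (h.mem_of_fn hf)
  · obtain ⟨t', L', h, -⟩ := h3 v hv
    exact ⟨t', L', h⟩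

theorem lhsNodes_eq (ρ : XRule) : lhsNodes ρ = (flatML (fun _ => none) 0 [lhsTm ρ]).2 := by
  rw [flatML_singleton]; rfl

/-- The left-hand side variable node a variable of the right-hand side refers to. -/
def lhsVar (ρ : XRule) (x : ℕ) : Option ℕ :=
  (lhsNodes ρ).findIdx? fun nd => decide (nd.1 = Sum.inl x)

theorem rhsFlat_eq (ρ : XRule) :
    flatML (lhsVar ρ) (lhsNodes ρ).length [ρ.2.2] = ([(rhsFlat ρ).1], (rhsFlat ρ).2) := by
  rw [flatML_singleton]; rfl

theorem filterMap_nodeVar_lhsNodes (ρ : XRule) :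
    (lhsNodes ρ).filterMap nodeVar = seqVars ρ.2.1 := by
  rw [lhsNodes_eq, filterMap_nodeVar_flatML]
  simp [varsX_lhsTm]

theorem lhsVar_eq_some {ρ : XRule} {x i : ℕ} (h : lhsVar ρ x = some i) :
    ∃ nd, (lhsNodes ρ)[i]? = some nd ∧ nd.1 = .inl x := by
  obtain ⟨hi, hp, -⟩ := List.findIdx?_eq_some_iff_getElem.1 h
  exact ⟨_, List.getElem?_eq_getElem hi, by simpa using hp⟩

theorem lhsVar_of_getElem? {ρ : XRule} (hlin : (seqVars ρ.2.1).Nodup) {x i : ℕ} {nd : GNode}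
    (hi : (lhsNodes ρ)[i]? = some nd) (hx : nd.1 = .inl x) : lhsVar ρ x = some i := by
  obtain ⟨hlt, rfl⟩ := List.getElem?_eq_some_iff.1 hi
  rw [← filterMap_nodeVar_lhsNodes, List.Nodup, List.pairwise_filterMap,
    List.pairwise_iff_getElem] at hlin
  refine List.findIdx?_eq_some_iff_getElem.2 ⟨hlt, by simpa using hx, fun j hj hjx => ?_⟩
  exact hlin j i (hj.trans hlt) hlt hj x (nodeVar_eq_some.2 (by simpa using hjx)) x
    (nodeVar_eq_some.2 hx) rfl

theorem exists_lhsVar {ρ : XRule} {x : ℕ} (hx : x ∈ seqVars ρ.2.1) : ∃ i, lhsVar ρ x = some i := by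
  rw [← filterMap_nodeVar_lhsNodes, List.mem_filterMap] at hx
  obtain ⟨nd, hnd, hx⟩ := hx
  have : (lhsVar ρ x).isSome := by
    rw [lhsVar, List.findIdx?_isSome, List.any_eq_true]
    exact ⟨nd, hnd, by simpa using nodeVar_eq_some.1 hx⟩
  exact Option.isSome_iff_exists.1 this

/-- The result of firing the rule `ρ` at the match `φ`. -/
noncomputable def fire (G : TG) (ρ : XRule) (φ : ℕ → ℕ) : TG :=
  gcG (redirectG (buildG G (lhsNodes ρ).length φ (rhsFlat ρ).2) (φ 0)
    (resolveRef G (lhsNodes ρ).length φ (rhsFlat ρ).1))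

theorem NodesInst.rep_lhs {ρ : XRule} {φ : ℕ → ℕ} {σ : ℕ → CTm}
    (hφ : NodesInst G (XTm.instX σ) φ 0 (lhsNodes ρ)) :
    ∃ L, Rep G [φ 0] [XTm.instX σ (lhsTm ρ)] L := by
  rw [lhsNodes_eq] at hφ
  obtain ⟨L, h, -⟩ := hφ.rep_flatML (XTm.isHom_instX σ) [lhsTm ρ] 0 (by simp)
  exact ⟨L, by simpa [flatML_singleton, flatM_none_fst] using h⟩

theorem Represents.fire {ρ : XRule} (hvars : ∀ x ∈ XTm.varsX ρ.2.2, x ∈ seqVars ρ.2.1)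
    {t t' : XTm} (hG : Represents G t) {φ : ℕ → ℕ} {σ : ℕ → CTm}
    (hφ : NodesInst G (XTm.instX σ) φ 0 (lhsNodes ρ)) {C A B}
    (hC : Ctx G (φ 0) [G.root] C A B) (ht : [t] = C (XTm.instX σ (lhsTm ρ)))
    (ht' : [t'] = C (XTm.instX σ ρ.2.2)) : Represents (fire G ρ φ) t' := by
  obtain ⟨Ls, hs⟩ := hφ.rep_lhs
  have hw := hs.lt.1 (φ 0) (by simp)
  obtain ⟨f, hf⟩ : ∃ f, G.label (φ 0) = .inr (.inr f) := by
    rw [instX_lhsTm] at hs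
    cases hs with | fn _ h => exact ⟨_, h⟩
  have hwL := hs.mem_of_fn hf
  obtain ⟨L, hL, hnd, -⟩ := hG.root
  obtain rfl : L = A ++ Ls ++ B := by
    have := hC.fill hs
    rw [← ht] at this
    exact (hL.unique this).2
  have hLlt := hL.lt.2
  have hA : φ 0 ∉ A := by
    simp only [List.append_assoc, List.nodup_append] at hnd
    exact fun h => hnd.2.2 _ h (φ 0) (by simp [hwL]) rfl
  have hB : φ 0 ∉ B := by
    simp only [List.nodup_append] at hnd
    exact fun h => hnd.2.2 (φ 0) (by simp [hwL]) _ h rfl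
  set NL := (lhsNodes ρ).length with hNL
  set w' := resolveRef G NL φ (rhsFlat ρ).1 with hw'
  set K := redirectG (buildG G NL φ (rhsFlat ρ).2) (φ 0) w' with hKdef
  set red : ℕ → ℕ := fun x => if x = φ 0 then w' else x with hred
  have hK : IsRedirect G K (φ 0) w' := by
    refine ⟨by simp [hKdef, redirectG, buildG], fun v hv => ?_, fun v hv => ?_⟩
    · simp [hKdef, redirectG, buildG, hv]
    · simp [hKdef, redirectG, buildG, hv]
  have hψ : ∀ i, red (resolveRef G NL φ (NL + i)) = G.n + i := by
    intro i
    have : G.n + i ≠ φ 0 := by omega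
    simp [hred, resolveRef, this]
  have hnovar : ∀ nd ∈ (rhsFlat ρ).2, ∀ x, nd.1 ≠ .inl x := by
    intro nd hnd x hx
    have hmem : x ∈ (rhsFlat ρ).2.filterMap nodeVar :=
      List.mem_filterMap.2 ⟨nd, hnd, nodeVar_eq_some.2 hx⟩
    have e := filterMap_nodeVar_flatML (lhsVar ρ) [ρ.2.2] NL
    rw [rhsFlat_eq] at e
    rw [e] at hmem
    simp only [List.map_cons, List.map_nil, List.flatten_cons, List.flatten_nil, List.append_nil,
      List.mem_filter, Option.isNone_iff_eq_none] at hmem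
    obtain ⟨i, hi⟩ := exists_lhsVar (hvars x hmem.1)
    simp [hi] at hmem
  have hrhs : NodesInst K (XTm.instX σ) (fun r => red (resolveRef G NL φ r)) NL
      (flatML (lhsVar ρ) NL [ρ.2.2]).2 := by
    rw [rhsFlat_eq]
    intro i nd hi
    obtain ⟨hlt, -⟩ := List.getElem?_eq_some_iff.1 hi
    refine ⟨fun x hx => absurd hx (hnovar nd (List.mem_of_getElem? hi) x), fun s hs => ?_⟩
    simp only [hψ]
    refine ⟨by simpa [hKdef, redirectG, buildG] using hlt, ?_, ?_⟩
    · simp [hKdef, redirectG, buildG, hi, hs]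
    · simp [hKdef, redirectG, buildG, hi, hred]
  obtain ⟨L', hr, hsub, -⟩ := hrhs.rep_flatML (XTm.isHom_instX σ) [ρ.2.2] NL (by
    intro x _ i hi
    obtain ⟨nd, hnd, hx⟩ := lhsVar_eq_some hi
    have hlt : i < NL := (List.getElem?_eq_some_iff.1 hnd).1
    have := (hφ i nd hnd).1 x hx
    have := hK.rep hf this (by simp)
    simpa [resolveRef, hlt] using this)
  rw [rhsFlat_eq] at hr hsub
  have hL' : L'.Sublist (List.range' G.n (rhsFlat ρ).2.length) := by
    convert hsub using 1
    refine List.ext_getElem (by simp) fun i _ _ => ?_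
    simp [hψ]
  have hroot : red w' = w' := by simp [hred]
  have hr' : Rep K [w'] [XTm.instX σ ρ.2.2] L' := by
    simpa [← hw', hroot] using hr
  have hfill := (hK.ctx hf hC hA hB).fill hr'
  rw [← ht'] at hfill
  refine Rep.represents_gcG (K := K) hfill ?_
  have hL'nd := hL'.nodup List.nodup_range'
  have hge : ∀ v ∈ L', G.n ≤ v := fun v hv => (List.mem_range'_1.1 (hL'.subset hv)).1
  simp only [List.nodup_append, List.mem_append] at hnd hLlt ⊢
  refine ⟨⟨hnd.1.1, hL'nd, fun a ha b hb => ?_⟩, hnd.2.1, fun a ha b hb => ?_⟩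
  · exact ((hLlt a (.inl (.inl ha))).trans_le (hge b hb)).ne
  · rcases ha with ha | ha
    · exact hnd.2.2 a (.inl ha) b hb
    · exact ((hLlt b (.inr hb)).trans_le (hge a ha)).ne'

theorem Represents.exists_xRew {R : List XRule}
    (hR : ∀ ρ ∈ R, (seqVars ρ.2.1).Nodup ∧ ∀ x ∈ XTm.varsX ρ.2.2, x ∈ seqVars ρ.2.1)
    {t : XTm} (hG : Represents G t) {I : TG} (hI : GRew R G I) :
    ∃ t', XRew R t t' ∧ Represents I t' := by
  obtain ⟨ρ, hρ, φ, hm, rfl⟩ := hI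
  have hm' : ∀ i nd, (lhsNodes ρ)[i]? = some nd → φ i < G.n ∧
      (∀ x, nd.1 = .inl x → G.ConPathsFrom (φ i)) ∧
      ∀ s, nd.1 = .inr s → G.label (φ i) = .inr s ∧ G.succ (φ i) = nd.2.map φ := by
    intro i nd hi
    obtain ⟨h1, h2⟩ := hm i (List.getElem?_eq_some_iff.1 hi).1
    simp only [List.getD_eq_getElem?_getD, hi, Option.getD_some] at h2
    refine ⟨h1, fun x hx => ?_, fun s hs => ?_⟩
    · rwa [hx] at h2
    · rwa [hs] at h2
  have hσ : ∀ x, ∃ s : CTm, ∀ i, lhsVar ρ x = some i → Rep G [φ i] [s.toX] [] := by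
    intro x
    cases hx : lhsVar ρ x with
    | none => exact ⟨.mk 0 [], by simp⟩
    | some i =>
      obtain ⟨nd, hnd, hx⟩ := lhsVar_eq_some hx
      obtain ⟨h1, h2, -⟩ := hm' i nd hnd
      obtain ⟨t', L', h⟩ := hG.total _ h1
      obtain ⟨rfl, cs, hcs⟩ := h.exists_toX (by simpa using h2 x hx)
      cases cs with
      | nil => simp at hcs
      | cons s cs =>
        obtain ⟨rfl, -⟩ := by simpa using hcs
        exact ⟨s, fun j hj => by cases hj; exact h⟩
  choose σ hσ using hσ
  have hφ : NodesInst G (XTm.instX σ) φ 0 (lhsNodes ρ) := by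
    intro i nd hi
    obtain ⟨h1, -, h2⟩ := hm' i nd hi
    rw [Nat.zero_add]
    refine ⟨fun x hx => ?_, fun s hs => ⟨h1, h2 s hs⟩⟩
    rw [XTm.instX_xv]
    exact hσ x i (lhsVar_of_getElem? (hR ρ hρ).1 hi hx)
  obtain ⟨Ls, hs⟩ := hφ.rep_lhs
  obtain ⟨f, hf⟩ : ∃ f, G.label (φ 0) = .inr (.inr f) := by
    rw [instX_lhsTm] at hs
    cases hs with | fn _ h => exact ⟨_, h⟩
  obtain ⟨L, hL, -, hfun⟩ := hG.root
  obtain ⟨C, A, B, s, Ls', hC, hs', e⟩ := hL.exists_ctx (hfun _ (hs.lt.1 _ (by simp)) f hf)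
  obtain rfl : s = XTm.instX σ (lhsTm ρ) := by simpa using (hs'.unique hs).1
  have hroot : XRew R (XTm.instX σ (lhsTm ρ)) (XTm.instX σ ρ.2.2) := by
    rw [instX_lhsTm]
    exact .root hρ
  obtain ⟨l, a, a', r, ea, ea', hx⟩ := hC.xRew hroot
  rw [← e] at ea
  obtain ⟨rfl, rfl, rfl⟩ : l = [] ∧ t = a ∧ r = [] := by
    cases l with
    | nil => simpa using ea
    | cons => simp at ea
  exact ⟨a', hx, hG.fire (hR ρ hρ).2 hφ hC e ea'.symm⟩

theorem Represents.exists_gRew {R : List XRule}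
    (hR : ∀ ρ ∈ R, (seqVars ρ.2.1).Nodup ∧ ∀ x ∈ XTm.varsX ρ.2.2, x ∈ seqVars ρ.2.1)
    {t t' : XTm} (hG : Represents G t) (ht : XRew R t t') :
    ∃ I, GRew R G I ∧ Represents I t' := by
  obtain ⟨ρ, hρ, σ, hred⟩ := Rep.exists_redex (G := G) ht
  obtain ⟨L, hL, -⟩ := hG.root
  obtain ⟨w, C, A, B, Ls, hC, hs, e, e'⟩ := hred hL
  obtain ⟨φ, hw, hφ⟩ := Rep.exists_nodesInst (XTm.isHom_instX σ)
    (fun h => h.nil_of_isC (by rw [XTm.instX_xv]; exact CTm.isC_toX _)) [lhsTm ρ] (o := 0)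
    (vs := [w]) hs
  rw [← lhsNodes_eq] at hφ
  obtain rfl : φ 0 = w := by simpa [flatML_singleton, flatM_none_fst] using hw
  refine ⟨_, ⟨ρ, hρ, φ, fun i hi => ?_, rfl⟩, hG.fire (hR ρ hρ).2 hφ hC e e'⟩
  obtain ⟨h1, h2⟩ := hφ i _ (List.getElem?_eq_getElem hi)
  simp only [List.getD_eq_getElem?_getD, List.getElem?_eq_getElem hi, Option.getD_some]
  rw [Nat.zero_add] at h1 h2
  generalize (lhsNodes ρ)[i] = nd at h1 h2
  obtain ⟨x | s, ss⟩ := nd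
  · have := h1 x rfl
    refine ⟨this.lt.1 _ (by simp), this.conPathsFrom ?_⟩
    rw [XTm.instX_xv]
    exact CTm.isC_toX _
  · exact h2 s rfl

end TG

theorem stepsN_simulation {α β : Type*} {r : α → α → Prop} {s : β → β → Prop} {I : α → β → Prop}
    (h : ∀ a b a', I a b → r a a' → ∃ b', s b b' ∧ I a' b') {n : ℕ} {a a' : α} {b : β}
    (hI : I a b) (hr : stepsN r n a a') : ∃ b', stepsN s n b b' ∧ I a' b' := by
  induction n generalizing a b with
  | zero => exact ⟨b, rfl, hr ▸ hI⟩
  | succ n ih =>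
    obtain ⟨c, hc, hr⟩ := hr
    obtain ⟨d, hd, hI'⟩ := h _ _ _ hI hc
    obtain ⟨b', hb, hI''⟩ := ih hI' hr
    exact ⟨b', ⟨d, hd, hb⟩, hI''⟩

/-- Graph Reducibility: for every orthogonal constructor
rewrite system `R` and every term `t`: `t →ⁿ u` in `R` with `u` a normal form
iff `[t] →ⁿ G` in `[R]` with `G` a normal form and `⟦G⟧ = u`. In particular
the number of rewrite steps is the same. -/
theorem graph_reducibility (g : ℕ) (arC : Fin g → ℕ) (h : ℕ)
    (arF : Fin h → ℕ) (R : List XRule)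
    (hwfR : ∀ ρ ∈ R, (∃ hf : ρ.1 < h, ρ.2.1.length = arF ⟨ρ.1, hf⟩) ∧
      (∀ p ∈ ρ.2.1, Pat.WFP g arC p) ∧ (seqVars ρ.2.1).Nodup ∧
      (∀ x ∈ XTm.varsX ρ.2.2, x ∈ seqVars ρ.2.1))
    (hortho : ∀ ρ₁ ∈ R, ∀ ρ₂ ∈ R, ρ₁.1 = ρ₂.1 →
      ∀ ts : List CTm, (∀ t ∈ ts, CTm.WFC g arC t) →
        MatchesSeq ρ₁.2.1 ts → MatchesSeq ρ₂.2.1 ts → ρ₁ = ρ₂)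
    (t u : XTm) (n : ℕ) :
    (stepsN (XRew R) n t u ∧ NormalForm (XRew R) u) ↔
      (∃ G : TG, stepsN (GRew R) n (toGraph t) G ∧
        NormalForm (GRew R) G ∧ G.unfold = u) := by
  have hR : ∀ ρ ∈ R, (seqVars ρ.2.1).Nodup ∧ ∀ x ∈ XTm.varsX ρ.2.2, x ∈ seqVars ρ.2.1 :=
    fun ρ hρ => (hwfR ρ hρ).2.2
  have ht := TG.represents_toGraph t
  constructor
  · rintro ⟨hsteps, hnf⟩
    obtain ⟨G, hG, hrep⟩ := stepsN_simulation (I := fun t G => TG.Represents G t)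
      (fun a G a' hG ha => hG.exists_gRew hR ha) ht hsteps
    refine ⟨G, hG, fun ⟨I, hI⟩ => ?_, ?_⟩
    · obtain ⟨t', ht', -⟩ := hrep.exists_xRew hR hI
      exact hnf ⟨t', ht'⟩
    · obtain ⟨L, hL, -⟩ := hrep.root
      exact hL.unfold_eq
  · rintro ⟨G, hsteps, hnf, rfl⟩
    obtain ⟨u, hu, hrep⟩ := stepsN_simulation (I := TG.Represents)
      (fun G a I hG hI => hG.exists_xRew hR hI) ht hsteps
    obtain ⟨L, hL, -⟩ := hrep.root
    rw [hL.unfold_eq]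
    refine ⟨hu, fun ⟨u', hu'⟩ => ?_⟩
    obtain ⟨I, hI, -⟩ := hrep.exists_gRew hR hu'
    exact hnf ⟨I, hI⟩
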